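/- arXiv:1312.7094 — 3 statements merged into one kernel-verified Lean document; each statement's English description precedes it below -/
import Mathlib

section
/- Let S be a commutative semiring, let n ≥ 1, and let A = (a_{ij}) be an n×n stochastic matrix over S, i.e. Σ_{j=1}^n a_{ij} = 1 for every i. Then the rooted spanning tree vector w of A satisfies Aᵀ·w = w, that is, Σ_{j=1}^n a_{ji}·w_j = w_i for every i. -/
open scoped Classical

/-- Every vertex reaches `i` under iteration of `f`. -/
def ReachesAll {V : Type*} (f : V → V) (i : V) : Prop :=
  ∀ j : V, ∃ m : ℕ, f^[m] j = i

lemma exists_iterate_eq_of_eq_off {V : Type*} {f g : V → V} {i : V}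
    (hfg : ∀ x, x ≠ i → g x = f x) (m : ℕ) (x : V) (h : f^[m] x = i) :
    ∃ k : ℕ, g^[k] x = i := by
  induction m generalizing x with
  | zero => exact ⟨0, h⟩
  | succ m ih =>
    by_cases hx : x = i
    · exact ⟨0, hx⟩
    · obtain ⟨k, hk⟩ := ih (f x) h
      exact ⟨k + 1, by rw [Function.iterate_succ_apply, hfg x hx, hk]⟩

lemma ReachesAll.update {V : Type*} {f : V → V} {i : V} (h : ReachesAll f i) (c : V) :
    ReachesAll (Function.update f i c) i := fun j ↦ by
  obtain ⟨m, hm⟩ := h j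
  exact exists_iterate_eq_of_eq_off (fun x hx ↦ Function.update_of_ne hx _ _) m j hm

lemma ReachesAll.mem_periodicPts {V : Type*} {f : V → V} {i : V} (h : ReachesAll f i) :
    i ∈ Function.periodicPts f := by
  obtain ⟨m, hm⟩ := h (f i)
  exact ⟨m + 1, m.succ_pos, hm⟩

lemma ReachesAll.apply {V : Type*} {f : V → V} {i : V} (h : ReachesAll f i) :
    ReachesAll f (f i) := fun j ↦ by
  obtain ⟨m, hm⟩ := h j
  exact ⟨m + 1, by rw [Function.iterate_succ_apply', hm]⟩

lemma ReachesAll.iterate {V : Type*} {f : V → V} {i : V} (h : ReachesAll f i) (m : ℕ) :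
    ReachesAll f (f^[m] i) := by
  induction m with
  | zero => exact h
  | succ m ih => rw [Function.iterate_succ_apply']; exact ih.apply

/-- If every vertex reaches `i`, then `i` has exactly one predecessor on the cycle of `f`. -/
lemma ReachesAll.existsUnique_pred {V : Type*} {f : V → V} {i : V} (h : ReachesAll f i) :
    ∃! j, f j = i ∧ ReachesAll f j := by
  obtain ⟨m, hm⟩ := h (f i)
  have hpred : f (f^[m] i) = i := by
    rw [← Function.iterate_succ_apply' f m i, Function.iterate_succ_apply, hm]
  refine ⟨f^[m] i, ⟨hpred, h.iterate m⟩, ?_⟩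
  rintro j ⟨hj, hj'⟩
  refine (Function.bijOn_periodicPts f).injOn hj'.mem_periodicPts
    (h.iterate m).mem_periodicPts ?_
  rw [hj, hpred]

/-- The total weight of all spanning `i`-trees. -/
noncomputable def spanningTreeWeight {V S : Type*} [Fintype V] [CommSemiring S]
    (a : V → V → S) (i : V) : S :=
  ∑ f ∈ Finset.univ.filter (fun f : V → V => f i = i ∧ ReachesAll f i),
    ∏ k ∈ Finset.univ.filter (fun k : V => k ≠ i), a k (f k)

/-- Adding the edge `(j, i)` to the spanning `j`-trees gives the functional digraphs whose
unique cycle contains that edge. -/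
lemma mul_spanningTreeWeight {V S : Type*} [Fintype V] [CommSemiring S] (a : V → V → S)
    (i j : V) :
    a j i * spanningTreeWeight a j =
      ∑ g ∈ Finset.univ.filter (fun g : V → V => g j = i ∧ ReachesAll g j),
        ∏ k, a k (g k) := by
  rw [spanningTreeWeight, Finset.mul_sum]
  refine Finset.sum_bij' (fun f _ ↦ Function.update f j i) (fun g _ ↦ Function.update g j j)
    ?_ ?_ ?_ ?_ ?_
  · intro f hf
    simp only [Finset.mem_filter, Finset.mem_univ, true_and] at hf ⊢
    exact ⟨Function.update_self _ _ _, hf.2.update i⟩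
  · intro g hg
    simp only [Finset.mem_filter, Finset.mem_univ, true_and] at hg ⊢
    exact ⟨Function.update_self _ _ _, hg.2.update j⟩
  · intro f hf
    simp only [Finset.mem_filter, Finset.mem_univ, true_and] at hf
    rw [Function.update_idem, Function.update_eq_self_iff, hf.1]
  · intro g hg
    simp only [Finset.mem_filter, Finset.mem_univ, true_and] at hg
    rw [Function.update_idem, Function.update_eq_self_iff, hg.1]
  · intro f _
    rw [← Finset.mul_prod_erase Finset.univ _ (Finset.mem_univ j), Function.update_self,
      Finset.filter_ne']
    congr 1
    refine Finset.prod_congr rfl fun k hk ↦ ?_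
    rw [Function.update_of_ne (Finset.ne_of_mem_erase hk)]

/-- For a stochastic matrix, the weight of all spanning `i`-trees is the weight of all
functional digraphs in which every vertex reaches `i`. -/
lemma spanningTreeWeight_eq_sum {V S : Type*} [Fintype V] [CommSemiring S] (a : V → V → S)
    (i : V) (hi : ∑ j, a i j = 1) :
    spanningTreeWeight a i =
      ∑ g ∈ Finset.univ.filter (fun g : V → V => ReachesAll g i), ∏ k, a k (g k) := by
  rw [← one_mul (spanningTreeWeight a i), ← hi, Finset.sum_mul]
  simp_rw [mul_spanningTreeWeight]
  rw [← Finset.sum_fiberwise _ (fun g : V → V ↦ g i)]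
  simp_rw [Finset.filter_filter, and_comm]

/-- The functional digraphs in which every vertex reaches `i`, sorted by the predecessor of `i`
on their cycle. -/
lemma sum_sum_pred_eq {V M : Type*} [Fintype V] [AddCommMonoid M] (W : (V → V) → M) (i : V) :
    ∑ j, ∑ g ∈ Finset.univ.filter (fun g : V → V => g j = i ∧ ReachesAll g j), W g =
      ∑ g ∈ Finset.univ.filter (fun g : V → V => ReachesAll g i), W g := by
  simp_rw [Finset.sum_filter]
  rw [Finset.sum_comm]
  refine Finset.sum_congr rfl fun g _ ↦ ?_
  split_ifs with h
  · obtain ⟨j, hj, huniq⟩ := h.existsUnique_pred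
    rw [Finset.sum_eq_single j (fun k _ hk ↦ if_neg fun hk' ↦ hk (huniq k hk'))
      (fun hj' ↦ absurd (Finset.mem_univ j) hj'), if_pos hj]
  · refine Finset.sum_eq_zero fun j _ ↦ if_neg ?_
    rintro ⟨rfl, hj⟩
    exact h hj.apply

/-- **Markov Chain Tree Theorem in commutative semirings.**  If `A` is stochastic
(all row sums equal `1`), then the rooted spanning tree vector `w` (with
`w i` the total weight of all spanning `i`-trees) satisfies `Aᵀ · w = w`. -/
theorem stmt_1 {S : Type*} [CommSemiring S] {n : ℕ} (hn : 1 ≤ n)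
    (a : Fin n → Fin n → S)
    (hstoch : ∀ i : Fin n, ∑ j : Fin n, a i j = 1)
    (w : Fin n → S)
    (hw : ∀ i : Fin n, w i =
      ∑ f ∈ Finset.univ.filter
          (fun f : Fin n → Fin n => f i = i ∧ ∀ j : Fin n, ∃ m : ℕ, f^[m] j = i),
        ∏ j ∈ Finset.univ.filter (fun j : Fin n => j ≠ i), a j (f j)) :
    ∀ i : Fin n, ∑ j : Fin n, a j i * w j = w i := by
  intro i
  have hw' (j : Fin n) : w j = spanningTreeWeight a j := by
    rw [hw j]
    unfold spanningTreeWeight ReachesAll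
    congr!
  rw [hw' i, spanningTreeWeight_eq_sum a i (hstoch i), ← sum_sum_pred_eq]
  refine Finset.sum_congr rfl fun j _ ↦ ?_
  rw [hw' j, mul_spanningTreeWeight]
end

section
/- Let S be a commutative semiring, let n ≥ 1, let A = (a_{ij}) be an n×n matrix over S, and fix i ∈ {1,…,n}. Then the total weight of all i-unicyclic functional digraphs equals Σ_{j ≠ i} w_j · a_{ji}, where w is the rooted spanning tree vector of A; that is, Σ_{g i-unicyclic} Π_{k=1}^n a_{k, g(k)} = Σ_{j ≠ i} w_j · a_{ji}. -/
open scoped Classical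

open Function in
/-- If `f` and `g` agree away from `j`, an `f`-orbit that reaches `j` yields a `g`-orbit that
reaches `j`. -/
theorem exists_iterate_eq_of_eqOn_compl {α : Type*} {f g : α → α} {j : α}
    (h : ∀ k, k ≠ j → f k = g k) {k : α} (hk : ∃ m, f^[m] k = j) : ∃ m, g^[m] k = j := by
  obtain ⟨m, hm⟩ := hk
  induction m generalizing k with
  | zero => exact ⟨0, hm⟩
  | succ m ih =>
    by_cases hkj : k = j
    · exact ⟨0, hkj⟩
    · rw [iterate_succ_apply] at hm
      obtain ⟨l, hl⟩ := ih hm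
      exact ⟨l + 1, by rw [iterate_succ_apply, ← h k hkj, hl]⟩

open Function in
/-- A point that maps to `i` and is reachable from `i` is periodic. -/
theorem mem_periodicPts_of_apply_eq {α : Type*} {g : α → α} {i j : α} (hj : g j = i)
    (h : ∃ m, g^[m] i = j) : j ∈ periodicPts g := by
  obtain ⟨m, hm⟩ := h
  exact mk_mem_periodicPts (Nat.succ_pos m) (by
    rw [IsPeriodicPt, IsFixedPt, iterate_succ_apply, hj, hm])

/-- Redirecting the root `j` of a spanning tree to `i` does not destroy paths to `j`. -/
theorem exists_iterate_update_eq {α : Type*} [DecidableEq α] {f : α → α} {j k : α} (i : α)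
    (hk : ∃ m, f^[m] k = j) : ∃ m, (Function.update f j i)^[m] k = j :=
  exists_iterate_eq_of_eqOn_compl (fun _ h => (Function.update_of_ne h _ _).symm) hk

/-- The total weight of all `i`-unicyclic functional digraphs (functions
`g : Fin n → Fin n` with `g i ≠ i` and every vertex reaching `i` in at least one
step; weight `∏ k, a k (g k)`) equals `∑_{j ≠ i} w j * a j i`, where `w` is the
rooted spanning tree vector of `A`. -/
theorem stmt_3 {S : Type*} [CommSemiring S] {n : ℕ} (hn : 1 ≤ n)
    (a : Fin n → Fin n → S) (i : Fin n)
    (w : Fin n → S)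
    (hw : ∀ i : Fin n, w i =
      ∑ f ∈ Finset.univ.filter
          (fun f : Fin n → Fin n => f i = i ∧ ∀ j : Fin n, ∃ m : ℕ, f^[m] j = i),
        ∏ j ∈ Finset.univ.filter (fun j : Fin n => j ≠ i), a j (f j)) :
    ∑ g ∈ Finset.univ.filter
        (fun g : Fin n → Fin n => g i ≠ i ∧ ∀ j : Fin n, ∃ m : ℕ, 1 ≤ m ∧ g^[m] j = i),
      ∏ k : Fin n, a k (g k) =
    ∑ j ∈ Finset.univ.filter (fun j : Fin n => j ≠ i), w j * a j i := by
  simp only [hw, Finset.sum_mul]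
  rw [Finset.sum_sigma']
  symm
  refine Finset.sum_bij (fun p _ => Function.update p.2 p.1 i) ?_ ?_ ?_ ?_
  · rintro ⟨j, f⟩ hp
    simp only [Finset.mem_sigma, Finset.mem_filter, Finset.mem_univ, true_and] at hp ⊢
    obtain ⟨hji, -, hf⟩ := hp
    refine ⟨?_, fun k => ?_⟩
    · rw [Function.update_of_ne hji.symm]
      intro hfi
      obtain ⟨m, hm⟩ := hf i
      rw [Function.iterate_fixed hfi] at hm
      exact hji hm.symm
    · obtain ⟨m, hm⟩ := exists_iterate_update_eq i (hf k)
      exact ⟨m + 1, Nat.succ_pos m, by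
        rw [Function.iterate_succ_apply', hm, Function.update_self]⟩
  · rintro ⟨j, f⟩ hp ⟨j', f'⟩ hp' h
    simp only [Finset.mem_sigma, Finset.mem_filter, Finset.mem_univ, true_and] at hp hp' h
    obtain ⟨-, hfj, hf⟩ := hp
    obtain ⟨-, hfj', hf'⟩ := hp'
    have hj : Function.update f j i j = i := Function.update_self ..
    have hj' : Function.update f j i j' = i := by rw [h, Function.update_self]
    have hjj' : j = j' :=
      (Function.bijOn_periodicPts (Function.update f j i)).injOn
        (mem_periodicPts_of_apply_eq hj (exists_iterate_update_eq i (hf i)))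
        (mem_periodicPts_of_apply_eq hj' (h ▸ exists_iterate_update_eq i (hf' i)))
        (hj.trans hj'.symm)
    subst hjj'
    have hff' : f = f' := by
      rw [← Function.update_eq_self j f, ← Function.update_eq_self j f', hfj, hfj',
        ← Function.update_idem (β := fun _ => Fin n) i j f, h, Function.update_idem]
    rw [hff']
  · intro g hg
    simp only [Finset.mem_filter, Finset.mem_univ, true_and] at hg
    obtain ⟨hgi, hg⟩ := hg
    obtain ⟨m, hm, hmi⟩ := hg i
    obtain ⟨m, rfl⟩ := Nat.exists_eq_add_of_le' hm
    rw [Function.iterate_succ_apply'] at hmi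
    refine ⟨⟨g^[m] i, Function.update g (g^[m] i) (g^[m] i)⟩, ?_, ?_⟩
    · simp only [Finset.mem_sigma, Finset.mem_filter, Finset.mem_univ, true_and]
      refine ⟨fun h => hgi (by rwa [h] at hmi), Function.update_self .., fun k => ?_⟩
      obtain ⟨l, -, hl⟩ := hg k
      exact exists_iterate_update_eq _ ⟨m + l, by rw [Function.iterate_add_apply, hl]⟩
    · simp only [Function.update_idem]
      rw [Function.update_eq_iff]
      exact ⟨hmi.symm, fun _ _ => rfl⟩
  · rintro ⟨j, f⟩ -
    dsimp only
    rw [Finset.filter_ne', ← Finset.prod_erase_mul _ _ (Finset.mem_univ j), Function.update_self]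
    congr 1
    exact Finset.prod_congr rfl fun k hk => by
      rw [Function.update_of_ne (Finset.ne_of_mem_erase hk)]
end

section
/- Let S be a commutative semiring, let n ≥ 2, and let a_2, …, a_n ∈ S with s = a_2 + ⋯ + a_n. Let D be a nonempty subset of {2,…,n} with n ∉ D, and let F be a forest on {2,…,n} whose trees are rooted at the vertices of D ∪ {n}, encoded by a function f : {2,…,n} → {2,…,n} with f(d) = d for all d ∈ D ∪ {n} and such that for every j there is an m with f^[m](j) ∈ D ∪ {n}. For l ∈ D ∪ {n}, let T_l(F) = { k ∈ {2,…,n} : ∃ m, f^[m](k) = l } be the vertex set of the tree of F rooted at l. Call a mapping τ : D → {2,…,n} admissible if the function h : {2,…,n} → {2,…,n} defined by h(d) = τ(d) for d ∈ D, h(n) = n, and h(j) = f(j) otherwise, encodes an n-tree on {2,…,n} (for every j there is an m with h^[m](j) = n). Then s^{|D|−1} · (Σ_{k ∈ T_n(F)} a_k) = Σ_{τ admissible} Π_{d ∈ D} a_{τ(d)}. -/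
open scoped Classical

/-- `Reaches f r j`: some iterate of `f` sends `j` to `r`. -/
def Reaches {α : Type*} (f : α → α) (r j : α) : Prop := ∃ m : ℕ, f^[m] j = r

/-- Override `f` by `t` on the finite set `D`. -/
noncomputable def overrideOn {α : Type*} (f : α → α) (D : Finset α) (t : α → α) : α → α :=
  fun j => if j ∈ D then t j else f j

namespace Reaches

variable {α : Type*} {f g : α → α} {r d e j k : α}

theorem refl (f : α → α) (r : α) : Reaches f r r := ⟨0, rfl⟩

theorem head (h : Reaches f r (f j)) : Reaches f r j := by
  obtain ⟨m, hm⟩ := h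
  exact ⟨m + 1, hm⟩

theorem induction_on {p : α → Prop} (h : Reaches f r j) (base : p r)
    (step : ∀ i, Reaches f r (f i) → p (f i) → p i) : p j := by
  obtain ⟨m, hm⟩ := h
  induction m generalizing j with
  | zero => exact (show j = r from hm) ▸ base
  | succ m ih => exact step j ⟨m, hm⟩ (ih hm)

theorem trans (h : Reaches f d j) (h' : Reaches f r d) : Reaches f r j :=
  h.induction_on h' fun _ _ => head

theorem eq_of_fixed (h : Reaches f r j) (hj : f j = j) : j = r := by
  obtain ⟨m, hm⟩ := h
  rwa [Function.iterate_fixed hj] at hm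

theorem apply (h : Reaches f r j) (hr : f r = r) : Reaches f r (f j) := by
  obtain ⟨m, hm⟩ := h
  refine ⟨m, ?_⟩
  rw [← Function.iterate_succ_apply, Function.iterate_succ_apply', hm, hr]

theorem mem_of_invariant {p : α → Prop} (h : Reaches f r j) (hp : ∀ i, p i → p (f i))
    (hj : p j) : p r := by
  obtain ⟨m, hm⟩ := h
  induction m generalizing j with
  | zero => exact (show j = r from hm) ▸ hj
  | succ m ih => exact ih (hp j hj) hm

theorem unique (hd : Reaches f d j) (he : Reaches f e j) (hfd : f d = d) (hfe : f e = e) :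
    d = e :=
  (he.mem_of_invariant (p := Reaches f d) (fun _ h => h.apply hfd) hd).eq_of_fixed hfe |>.symm

theorem update_self (h : Reaches f d j) : Reaches (Function.update f d k) d j := by
  refine h.induction_on (refl _ _) fun i _ hi => ?_
  by_cases hid : i = d
  · exact hid ▸ refl _ _
  · exact head (by rwa [Function.update_of_ne hid])

theorem update_of_ne (h : Reaches f e j) (hfd : f d = d) (hed : e ≠ d) :
    Reaches (Function.update f d k) e j := by
  refine h.induction_on (refl _ _) fun i hi ih => ?_
  have hid : i ≠ d := by
    rintro rfl
    exact hed (eq_of_fixed (head hi) hfd).symm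
  exact head (by rwa [Function.update_of_ne hid])

theorem update_iff (hfd : f d = d) (hrd : r ≠ d) (hk : ¬ Reaches f d k) :
    Reaches (Function.update f d k) r j ↔
      Reaches f r j ∨ (Reaches f d j ∧ Reaches f r k) := by
  constructor
  · intro h
    refine h.induction_on (p := fun i => Reaches f r i ∨ (Reaches f d i ∧ Reaches f r k))
      (Or.inl (refl _ _)) fun i _ ih => ?_
    by_cases hid : i = d
    · subst hid
      rw [Function.update_self] at ih
      exact Or.inr ⟨refl _ _, ih.resolve_right fun h => hk h.1⟩
    · rw [Function.update_of_ne hid] at ih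
      exact ih.imp head fun h => ⟨h.1.head, h.2⟩
  · rintro (h | ⟨h, h'⟩)
    · exact h.update_of_ne hfd hrd
    · refine h.update_self.trans (head ?_)
      rw [Function.update_self]
      exact h'.update_of_ne hfd hrd

end Reaches

/-- The maps that are the identity off `D`, send `D` into `V`, and such that overriding `f` with
them on `D` yields a function under whose iteration every vertex of `V` reaches `r`. -/
noncomputable def admissibleMaps {α : Type*} [Fintype α] (V : Finset α) (r : α) (f : α → α)
    (D : Finset α) : Finset (α → α) :=
  Finset.univ.filter fun t => (∀ j, j ∉ D → t j = j) ∧ (∀ d ∈ D, t d ∈ V) ∧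
    ∀ j ∈ V, Reaches (overrideOn f D t) r j

section admissibleMaps

variable {α : Type*} {V : Finset α} {r d k : α} {f : α → α} {D : Finset α}

theorem mem_admissibleMaps [Fintype α] {t : α → α} : t ∈ admissibleMaps V r f D ↔
    (∀ j, j ∉ D → t j = j) ∧ (∀ d ∈ D, t d ∈ V) ∧
      ∀ j ∈ V, Reaches (overrideOn f D t) r j := by
  simp [admissibleMaps]

theorem overrideOn_insert (hd : d ∉ D) (t : α → α) :
    overrideOn (Function.update f d (t d)) D (Function.update t d d) =
      overrideOn f (insert d D) t := by
  funext j
  by_cases hj : j = d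
  · subst hj
    simp [overrideOn, hd]
  · simp [overrideOn, hj]

theorem sum_admissibleMaps_insert [Fintype α] {S : Type*} [CommSemiring S] (a : α → S) (hd : d ∉ D) :
    ∑ t ∈ admissibleMaps V r f (insert d D), ∏ i ∈ insert d D, a (t i) =
      ∑ k ∈ V, a k * ∑ t ∈ admissibleMaps V r (Function.update f d k) D, ∏ i ∈ D, a (t i) := by
  simp_rw [Finset.mul_sum]
  rw [Finset.sum_sigma']
  refine Finset.sum_bij' (fun t _ => ⟨t d, Function.update t d d⟩)
    (fun p _ => Function.update p.2 d p.1) ?_ ?_ ?_ ?_ ?_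
  · intro t ht
    rw [mem_admissibleMaps] at ht
    obtain ⟨h1, h2, h3⟩ := ht
    rw [Finset.mem_sigma, mem_admissibleMaps]
    refine ⟨h2 d (by simp), fun j hj => ?_, fun i hi => ?_, fun j hj => ?_⟩
    · by_cases hjd : j = d
      · simp [hjd]
      · simpa [hjd] using h1 j (by simp [hjd, hj])
    · have hid : i ≠ d := fun h => hd (h ▸ hi)
      simpa [hid] using h2 i (by simp [hi])
    · simpa only [overrideOn_insert hd] using h3 j hj
  · rintro ⟨k, t⟩ ht
    rw [Finset.mem_sigma, mem_admissibleMaps] at ht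
    obtain ⟨hk, h1, h2, h3⟩ := ht
    rw [mem_admissibleMaps]
    have ht : Function.update (Function.update t d k) d d = t := by
      rw [Function.update_idem]
      exact Function.update_eq_iff.2 ⟨(h1 d hd).symm, fun _ _ => rfl⟩
    refine ⟨fun j hj => ?_, fun i hi => ?_, fun j hj => ?_⟩
    · rw [Finset.mem_insert, not_or] at hj
      simpa [hj.1] using h1 j hj.2
    · by_cases hid : i = d
      · simpa [hid] using hk
      · simpa [hid] using h2 i (Finset.mem_of_mem_insert_of_ne hi hid)
    · have := overrideOn_insert (f := f) hd (Function.update t d k)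
      rw [ht, Function.update_self] at this
      rw [← this]
      exact h3 j hj
  · intro t _
    simp
  · rintro ⟨k, t⟩ ht
    rw [Finset.mem_sigma, mem_admissibleMaps] at ht
    have ht : Function.update (Function.update t d k) d d = t := by
      rw [Function.update_idem]
      exact Function.update_eq_iff.2 ⟨(ht.2.1 d hd).symm, fun _ _ => rfl⟩
    simp [ht]
  · intro t _
    rw [Finset.prod_insert hd]
    congr 1
    refine Finset.prod_congr rfl fun i hi => ?_
    have hid : i ≠ d := fun h => hd (h ▸ hi)
    simp [hid]

theorem admissibleMaps_update_eq_empty [Fintype α] (hdV : d ∈ V) (hd : d ∉ D) (hfix : ∀ i ∈ D, f i = i)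
    (hfd : f d = d) (hfr : f r = r) (hrd : r ≠ d) (hk : Reaches f d k) :
    admissibleMaps V r (Function.update f d k) D = ∅ := by
  refine Finset.eq_empty_of_forall_notMem fun t ht => ?_
  have h := (mem_admissibleMaps.1 ht).2.2 d hdV
  refine hrd ((h.mem_of_invariant (p := Reaches f d) (fun i hi => ?_)
    (Reaches.refl f d)).eq_of_fixed hfr)
  by_cases hiD : i ∈ D
  · exact absurd (hi.eq_of_fixed (hfix i hiD) ▸ hiD) hd
  · by_cases hid : i = d
    · simpa [overrideOn, hid, hd] using hk
    · simpa [overrideOn, hiD, hid] using hi.apply hfd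

theorem admissibleMaps_empty [Fintype α] (h : ∀ j ∈ V, Reaches f r j) :
    admissibleMaps V r f ∅ = {id} := by
  ext t
  have ho : overrideOn f ∅ t = f := by
    funext j
    simp [overrideOn]
  rw [mem_admissibleMaps, ho, Finset.mem_singleton]
  constructor
  · rintro ⟨h1, -⟩
    exact funext fun j => h1 j (by simp)
  · rintro rfl
    exact ⟨fun _ _ => rfl, by simp, h⟩

/-- Hanging the root `d` of one tree of a forest on a vertex `k` of another tree gives a forest
with one root less. -/
theorem exists_root_update (hfd : f d = d)
    (hreach : ∀ j ∈ V, ∃ e, (e ∈ insert d D ∨ e = r) ∧ Reaches f e j)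
    (hkV : k ∈ V) (hk : ¬ Reaches f d k) :
    ∀ j ∈ V, ∃ e, (e ∈ D ∨ e = r) ∧ Reaches (Function.update f d k) e j := by
  have key : ∀ j ∈ V, ¬ Reaches f d j →
      ∃ e, (e ∈ D ∨ e = r) ∧ Reaches (Function.update f d k) e j := by
    intro j hj hjd
    obtain ⟨e, he, hje⟩ := hreach j hj
    have hed : e ≠ d := by
      rintro rfl
      exact hjd hje
    exact ⟨e, he.imp_left fun h => Finset.mem_of_mem_insert_of_ne h hed,
      hje.update_of_ne hfd hed⟩
  intro j hj
  by_cases hjd : Reaches f d j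
  · obtain ⟨e, he, hke⟩ := key k hkV hk
    refine ⟨e, he, hjd.update_self.trans (Reaches.head ?_)⟩
    rwa [Function.update_self]
  · exact key j hj hjd

theorem sum_filter_reaches_update {S : Type*} [CommSemiring S] (a : α → S) (hfd : f d = d)
    (hfr : f r = r) (hrd : r ≠ d) (hk : ¬ Reaches f d k) :
    ∑ j ∈ V with Reaches (Function.update f d k) r j, a j =
      (∑ j ∈ V with Reaches f r j, a j) +
        if Reaches f r k then ∑ j ∈ V with Reaches f d j, a j else 0 := by
  simp_rw [Reaches.update_iff hfd hrd hk]
  split_ifs with h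
  · simp only [h, and_true]
    rw [Finset.filter_or, Finset.sum_union]
    rw [Finset.disjoint_filter]
    exact fun j _ hr hd => hrd (hr.unique hd hfr hfd)
  · simp [h]

/-- The weighted count of the ways to complete a forest with roots `D ∪ {r}` to a tree
rooted at `r`. -/
theorem pow_mul_sum_eq_sum_admissibleMaps [Fintype α] {S : Type*} [CommSemiring S]
    (a : α → S) (hD : D.Nonempty) (hDV : D ⊆ V) (hrD : r ∉ D) (hfix : ∀ i ∈ D, f i = i) (hfr : f r = r)
    (hreach : ∀ j ∈ V, ∃ e, (e ∈ D ∨ e = r) ∧ Reaches f e j) :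
    (∑ j ∈ V, a j) ^ (D.card - 1) * ∑ j ∈ V with Reaches f r j, a j =
      ∑ t ∈ admissibleMaps V r f D, ∏ i ∈ D, a (t i) := by
  induction D using Finset.induction_on generalizing f with
  | empty => exact absurd hD Finset.not_nonempty_empty
  | insert d D hd ih =>
    have hrd : r ≠ d := fun h => hrD (by simp [h])
    have hfd : f d = d := hfix d (by simp)
    have hdV : d ∈ V := hDV (by simp)
    rw [sum_admissibleMaps_insert a hd,
      ← Finset.sum_filter_add_sum_filter_not V (fun k => Reaches f d k) (fun k => _ * _),
      Finset.sum_eq_zero (s := V.filter fun k => Reaches f d k), zero_add]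
    swap
    · intro k hk
      rw [admissibleMaps_update_eq_empty hdV hd (fun i hi => hfix i (by simp [hi])) hfd hfr hrd
        (Finset.mem_filter.1 hk).2, Finset.sum_empty, mul_zero]
    rw [Finset.card_insert_of_notMem hd, Nat.add_sub_cancel]
    rcases D.eq_empty_or_nonempty with rfl | hne
    · have hroot : ∀ k ∈ V, (¬ Reaches f d k ↔ Reaches f r k) := by
        intro k hk
        refine ⟨fun h => ?_, fun hr h => hrd (hr.unique h hfr hfd)⟩
        obtain ⟨e, he, hke⟩ := hreach k hk
        rcases he with he | rfl
        · rw [Finset.mem_insert, or_iff_left (Finset.notMem_empty e)] at he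
          exact absurd (he ▸ hke) h
        · exact hke
      rw [Finset.card_empty, pow_zero, one_mul, ← Finset.filter_congr hroot]
      refine Finset.sum_congr rfl fun k hk => ?_
      rw [Finset.mem_filter] at hk
      rw [admissibleMaps_empty]
      · simp
      · intro j hj
        obtain ⟨e, he, hje⟩ := exists_root_update hfd hreach hk.1 hk.2 j hj
        rwa [← he.resolve_left (Finset.notMem_empty e)]
    · have hstep : ∀ k ∈ V.filter (fun k => ¬ Reaches f d k),
          a k * ∑ t ∈ admissibleMaps V r (Function.update f d k) D, ∏ i ∈ D, a (t i) =
            (∑ j ∈ V, a j) ^ (D.card - 1) *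
              (a k * (∑ j ∈ V with Reaches f r j, a j) +
                if Reaches f r k then a k * ∑ j ∈ V with Reaches f d j, a j else 0) := by
        intro k hk
        rw [Finset.mem_filter] at hk
        rw [← ih hne (fun i hi => hDV (by simp [hi])) (fun h => hrD (by simp [h]))
          (f := Function.update f d k)
          (fun i hi => by
            rw [Function.update_of_ne (ne_of_mem_of_not_mem hi hd), hfix i (by simp [hi])])
          (by rw [Function.update_of_ne hrd, hfr])
          (exists_root_update hfd hreach hk.1 hk.2),
          sum_filter_reaches_update a hfd hfr hrd hk.2]
        split_ifs <;> ring
      rw [Finset.sum_congr rfl hstep, ← Finset.mul_sum, Finset.sum_add_distrib,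
        ← Finset.sum_mul, ← Finset.sum_filter, ← Finset.sum_mul, Finset.filter_filter]
      have hfilter : (V.filter fun k => ¬ Reaches f d k ∧ Reaches f r k) =
          V.filter fun k => Reaches f r k :=
        Finset.filter_congr fun k _ =>
          ⟨And.right, fun hr => ⟨fun h => hrd (hr.unique h hfr hfd), hr⟩⟩
      have hpos := hne.card_pos
      rw [hfilter, show D.card = (D.card - 1) + 1 by omega, pow_succ, Nat.add_sub_cancel,
        mul_assoc]
      congr 1
      rw [← Finset.sum_filter_add_sum_filter_not V (fun k => Reaches f d k) a]
      ring

end admissibleMaps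

/-- **The key combinatorial identity in Sonin's proof.**  Vertices are `Fin n`;
vertex `0` (standing for state `1`) is excluded, so the working vertex set
`{v ≠ 0}` stands for `{2,…,n}`, with weights `a v` and root the last vertex
(standing for `n`).  `D` is a nonempty subset of `{v ≠ 0}` not containing the
root, and `f` encodes a forest on `{v ≠ 0}` whose trees are rooted at the
vertices of `D ∪ {root}` (`f` fixes `D ∪ {root}` and iterates of every vertex
eventually reach `D ∪ {root}`); `T_l(F) = {k ≠ 0 : ∃ m, f^[m] k = l}` is the
tree of the forest rooted at `l`.  A mapping `τ : D → {v ≠ 0}` (encoded as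
`t : Fin n → Fin n` fixing the complement of `D`) is admissible when the
function `h` obtained from `f` by overriding it on `D` with `t` encodes a tree
on `{v ≠ 0}` rooted at the root.  With `s = ∑_{v ≠ 0} a v`:
`s^(|D|-1) * (∑_{k ∈ T_root(F)} a k) = ∑_{τ admissible} ∏_{d ∈ D} a (τ d)`. -/
theorem stmt_13 {S : Type*} [CommSemiring S] {n : ℕ} [NeZero n] (hn : 2 ≤ n)
    (a : Fin n → S)
    (s : S) (hs : s = ∑ j ∈ Finset.univ.filter (fun j : Fin n => j ≠ 0), a j)
    (D : Finset (Fin n)) (hDne : D.Nonempty) (hD0 : (0 : Fin n) ∉ D)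
    (hDroot : (⟨n - 1, by omega⟩ : Fin n) ∉ D)
    (f : Fin n → Fin n) (hf0 : f 0 = 0)
    (hfV : ∀ j : Fin n, j ≠ 0 → f j ≠ 0)
    (hffix : ∀ d : Fin n, (d ∈ D ∨ d = ⟨n - 1, by omega⟩) → f d = d)
    (hfreach : ∀ j : Fin n, j ≠ 0 →
      ∃ m : ℕ, f^[m] j ∈ D ∨ f^[m] j = ⟨n - 1, by omega⟩) :
    s ^ (D.card - 1) *
        (∑ k ∈ Finset.univ.filter
            (fun k : Fin n => k ≠ 0 ∧ ∃ m : ℕ, f^[m] k = ⟨n - 1, by omega⟩), a k) =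
      ∑ t ∈ Finset.univ.filter (fun t : Fin n → Fin n =>
          (∀ j : Fin n, j ∉ D → t j = j) ∧ (∀ d ∈ D, t d ≠ 0) ∧
            (fun j : Fin n => if j ∈ D then t j else f j) ⟨n - 1, by omega⟩ =
              ⟨n - 1, by omega⟩ ∧
            ∀ j : Fin n, j ≠ 0 →
              ∃ m : ℕ, (fun j : Fin n => if j ∈ D then t j else f j)^[m] j =
                ⟨n - 1, by omega⟩),
        ∏ d ∈ D, a (t d) := by
  have hfr := hffix ⟨n - 1, by omega⟩ (Or.inr rfl)
  have key := pow_mul_sum_eq_sum_admissibleMaps (V := Finset.univ.filter fun j : Fin n => j ≠ 0)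
    a hDne (fun d hd => by simpa using ne_of_mem_of_not_mem hd hD0) hDroot
    (fun d hd => hffix d (Or.inl hd)) hfr
    (fun j hj => by
      obtain ⟨m, hm⟩ := hfreach j (by simpa using hj)
      exact ⟨f^[m] j, hm, m, rfl⟩)
  rw [← hs, Finset.filter_filter] at key
  refine key.trans (Finset.sum_congr ?_ fun _ _ => rfl)
  ext t
  rw [mem_admissibleMaps, Finset.mem_filter]
  have ho : overrideOn f D t = fun j => if j ∈ D then t j else f j := by
    funext j
    unfold overrideOn
    split_ifs <;> rfl
  simp only [ho, Reaches, Finset.mem_filter, Finset.mem_univ, true_and, if_neg hDroot, hfr]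
end
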